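/- Let $\rho > 0$, $\alpha \in [0, 2\pi)$, and let $x, y, \theta : [0, \rho(\alpha + 2\pi)] \to \mathbb{R}$ be continuous with $(x(0), y(0), \theta(0)) = (0, 0, \pi/2)$, differentiable on $(0, \rho\alpha)$ and on $(\rho\alpha, \rho(\alpha + 2\pi))$, satisfying $\dot{x}(t) = \cos\theta(t)$ and $\dot{y}(t) = \sin\theta(t)$ on both open intervals, $\dot{\theta}(t) = 1/\rho$ on $(0, \rho\alpha)$, and $\dot{\theta}(t) = -1/\rho$ on $(\rho\alpha, \rho(\alpha + 2\pi))$. Then $x(\rho(\alpha + 2\pi)) = -\rho + \rho\cos\alpha$, $y(\rho(\alpha + 2\pi)) = \rho\sin\alpha$, and $\theta(\rho(\alpha + 2\pi)) = \pi/2 + \alpha - 2\pi$. -/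

import Mathlib

open Real Set

/-- A function continuous on `[a, b]` with zero derivative on `(a, b)` takes equal values at the
endpoints. -/
theorem eq_endpoints_of_hasDerivAt_zero {f : ℝ → ℝ} {a b : ℝ} (hab : a ≤ b)
    (hf : ContinuousOn f (Icc a b)) (hf' : ∀ t ∈ Ioo a b, HasDerivAt f 0 t) : f b = f a := by
  rcases hab.eq_or_lt with rfl | hlt
  · rfl
  · obtain ⟨c, -, hc⟩ := exists_hasDerivAt_eq_slope f (fun _ => 0) hlt hf hf'
    have hba : b - a ≠ 0 := (sub_pos.2 hlt).ne'
    field_simp at hc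
    linarith

/-- Endpoint of a unit-speed planar arc with constant nonzero curvature `k`. -/
theorem circular_arc_endpoint {x y θ : ℝ → ℝ} {a b k : ℝ} (hab : a ≤ b) (hk : k ≠ 0)
    (hxc : ContinuousOn x (Icc a b)) (hyc : ContinuousOn y (Icc a b))
    (hθc : ContinuousOn θ (Icc a b))
    (hx : ∀ t ∈ Ioo a b, HasDerivAt x (cos (θ t)) t)
    (hy : ∀ t ∈ Ioo a b, HasDerivAt y (sin (θ t)) t)
    (hθ : ∀ t ∈ Ioo a b, HasDerivAt θ k t) :
    x b = x a + (sin (θ b) - sin (θ a)) / k ∧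
    y b = y a - (cos (θ b) - cos (θ a)) / k ∧
    θ b = θ a + k * (b - a) := by
  have h₁ := eq_endpoints_of_hasDerivAt_zero (f := fun t => x t - sin (θ t) / k) hab
    (hxc.sub ((continuous_sin.comp_continuousOn hθc).div_const k)) fun t ht => by
      refine ((hx t ht).sub ((hθ t ht).sin.div_const k)).congr_deriv ?_
      field_simp
      ring
  have h₂ := eq_endpoints_of_hasDerivAt_zero (f := fun t => y t + cos (θ t) / k) hab
    (hyc.add ((continuous_cos.comp_continuousOn hθc).div_const k)) fun t ht => by
      refine ((hy t ht).add ((hθ t ht).cos.div_const k)).congr_deriv ?_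
      field_simp
      ring
  have h₃ := eq_endpoints_of_hasDerivAt_zero (f := fun t => θ t - k * t) hab
    (hθc.sub (by fun_prop)) fun t ht => by
      refine ((hθ t ht).sub ((hasDerivAt_id t).const_mul k)).congr_deriv ?_
      ring
  refine ⟨?_, ?_, ?_⟩
  · rw [sub_div]; linarith
  · rw [sub_div]; linarith
  · linarith

/-- Terminal configuration of the `LR₂π`-path: a counterclockwise arc of radian
`α` followed by a full clockwise circle, starting from `(0, 0, π/2)`. -/
theorem stmt_5 (ρ α : ℝ) (hρ : 0 < ρ) (hα : α ∈ Set.Ico (0:ℝ) (2 * π))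
    (x y θ : ℝ → ℝ)
    (hxc : ContinuousOn x (Set.Icc 0 (ρ * (α + 2 * π))))
    (hyc : ContinuousOn y (Set.Icc 0 (ρ * (α + 2 * π))))
    (hθc : ContinuousOn θ (Set.Icc 0 (ρ * (α + 2 * π))))
    (hx0 : x 0 = 0) (hy0 : y 0 = 0) (hθ0 : θ 0 = π / 2)
    (hx1 : ∀ t ∈ Set.Ioo (0:ℝ) (ρ * α), HasDerivAt x (Real.cos (θ t)) t)
    (hy1 : ∀ t ∈ Set.Ioo (0:ℝ) (ρ * α), HasDerivAt y (Real.sin (θ t)) t)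
    (hθ1 : ∀ t ∈ Set.Ioo (0:ℝ) (ρ * α), HasDerivAt θ (1 / ρ) t)
    (hx2 : ∀ t ∈ Set.Ioo (ρ * α) (ρ * (α + 2 * π)), HasDerivAt x (Real.cos (θ t)) t)
    (hy2 : ∀ t ∈ Set.Ioo (ρ * α) (ρ * (α + 2 * π)), HasDerivAt y (Real.sin (θ t)) t)
    (hθ2 : ∀ t ∈ Set.Ioo (ρ * α) (ρ * (α + 2 * π)), HasDerivAt θ (-1 / ρ) t) :
    x (ρ * (α + 2 * π)) = -ρ + ρ * Real.cos α ∧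
    y (ρ * (α + 2 * π)) = ρ * Real.sin α ∧
    θ (ρ * (α + 2 * π)) = π / 2 + α - 2 * π := by
  have hα0 : 0 ≤ ρ * α := mul_nonneg hρ.le hα.1
  have hle : ρ * α ≤ ρ * (α + 2 * π) := by gcongr; linarith [pi_pos]
  have hl : Icc 0 (ρ * α) ⊆ Icc 0 (ρ * (α + 2 * π)) := Icc_subset_Icc_right hle
  have hr : Icc (ρ * α) (ρ * (α + 2 * π)) ⊆ Icc 0 (ρ * (α + 2 * π)) := Icc_subset_Icc_left hα0
  obtain ⟨hx, hy, hθ⟩ := circular_arc_endpoint hα0 (by positivity)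
    (hxc.mono hl) (hyc.mono hl) (hθc.mono hl) hx1 hy1 hθ1
  obtain ⟨hx', hy', hθ'⟩ := circular_arc_endpoint hle (div_ne_zero (by norm_num) hρ.ne')
    (hxc.mono hr) (hyc.mono hr) (hθc.mono hr) hx2 hy2 hθ2
  have hmid : θ (ρ * α) = α + π / 2 := by
    rw [hθ, hθ0]; field_simp; ring
  have hend : θ (ρ * (α + 2 * π)) = α + π / 2 - 2 * π := by
    rw [hθ', hmid]; field_simp; ring
  rw [hx', hy', hx, hy, hend, hmid, hx0, hy0, hθ0, sin_sub_two_pi, cos_sub_two_pi,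
    sin_add_pi_div_two, cos_add_pi_div_two, sin_pi_div_two, cos_pi_div_two]
  refine ⟨?_, ?_, ?_⟩
  · field_simp; ring
  · field_simp; ring
  · ring
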